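/- Let D be a finite m-colored digraph without isolated vertices in which every chromatic class is transitive. If the color-class digraph 𝒞_C(D) contains no directed cycle of length at least two, then D has a kernel by rainbow paths. -/

import Mathlib

/- Digraphs are modeled as binary relations on a vertex type.  An `H`-colored digraph `D`
is a relation `D : V → V → Prop` together with a coloring `c : V → V → β` of its arcs by
vertices of a digraph `H : β → β → Prop` (possibly with loops). -/

variable {V β : Type*}

/-- The list of colors of the consecutive arcs along a list of vertices. -/
def arcColors (c : V → V → β) (l : List V) : List β :=
  (l.zip l.tail).map fun p => c p.1 p.2

/-- `l` is an `H`-walk in the digraph with arc relation `A`: it has at least two vertices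
(i.e. at least one arc), its consecutive pairs are arcs of `A`, and the sequence of colors
of its consecutive arcs is a walk in `H`. -/
def IsHWalk (A : V → V → Prop) (c : V → V → β) (H : β → β → Prop) (l : List V) : Prop :=
  2 ≤ l.length ∧ l.Chain' A ∧ (arcColors c l).Chain' H

/-- An `H`-path: an `H`-walk with pairwise distinct vertices. -/
def IsHPath (A : V → V → Prop) (c : V → V → β) (H : β → β → Prop) (l : List V) : Prop :=
  IsHWalk A c H l ∧ l.Nodup

/-- An `H`-path from `u` to `v`. -/
def IsHPathFrom (A : V → V → Prop) (c : V → V → β) (H : β → β → Prop) (u v : V)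
    (l : List V) : Prop :=
  IsHPath A c H l ∧ l.head? = some u ∧ l.getLast? = some v

/-- There exists a `uv`-`H`-path in the digraph with arc relation `A`. -/
def HPathExists (A : V → V → Prop) (c : V → V → β) (H : β → β → Prop) (u v : V) : Prop :=
  ∃ l, IsHPathFrom A c H u v l

/-- The digraph with arc relation `A` is transitive by `H`-paths. -/
def TransByHPaths (A : V → V → Prop) (c : V → V → β) (H : β → β → Prop) : Prop :=
  ∀ x y z, HPathExists A c H x y → HPathExists A c H y z → HPathExists A c H x z

/-- Arc relation of the subdigraph of `D` induced by the arcs whose color lies in `Cl`. -/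
def Garc (D : V → V → Prop) (c : V → V → β) (Cl : Set β) : V → V → Prop :=
  fun u v => D u v ∧ c u v ∈ Cl

/-- Given a partition `C : Fin k → Set β` of the colors and an assignment `σ` of the classes
to two parts, `DarcPart D c C σ j` is the arc relation of the spanning subdigraph `D_j`
whose arcs are those of `D` colored in some class of part `j`. -/
def DarcPart (D : V → V → Prop) (c : V → V → β) {k : ℕ} (C : Fin k → Set β)
    (σ : Fin k → Fin 2) (j : Fin 2) : V → V → Prop :=
  Garc D c {b | ∃ m, σ m = j ∧ b ∈ C m}

/-- `l` (a list of pairwise distinct vertices, of length at least two) is a directed cycle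
of the digraph with arc relation `A`, the closing arc going from the last vertex back to
the first one. -/
def IsCycle (A : V → V → Prop) (l : List V) : Prop :=
  2 ≤ l.length ∧ l.Nodup ∧ l.Chain' A ∧
    ∀ x ∈ l.getLast?, ∀ y ∈ l.head?, A x y

/-- Arc relation of the color-class digraph `𝒞_C(D)`: `(a, b)` is an arc iff there are arcs
`(u,v)` and `(v,w)` of `D` with colors `a` and `b` respectively. -/
def CCArc (D : V → V → Prop) (c : V → V → β) (a b : β) : Prop :=
  ∃ u v w, D u v ∧ D v w ∧ c u v = a ∧ c v w = b

/-- `S` is `H`-independent: no `H`-path between two distinct vertices of `S`. -/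
def HIndep (A : V → V → Prop) (c : V → V → β) (H : β → β → Prop) (S : Set V) : Prop :=
  ∀ u ∈ S, ∀ v ∈ S, u ≠ v → ¬ HPathExists A c H u v

/-- `S` is `H`-absorbent: from every vertex outside `S` there is an `H`-path to `S`. -/
def HAbsorbent (A : V → V → Prop) (c : V → V → β) (H : β → β → Prop) (S : Set V) : Prop :=
  ∀ u, u ∉ S → ∃ v ∈ S, HPathExists A c H u v

/-- An `H`-kernel: an `H`-independent and `H`-absorbent set. -/
def IsHKernel (A : V → V → Prop) (c : V → V → β) (H : β → β → Prop) (S : Set V) : Prop :=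
  HIndep A c H S ∧ HAbsorbent A c H S

/-- `S` is an `H`-semikernel of the digraph with arc relation `A`. -/
def IsHSemikernel (A : V → V → Prop) (c : V → V → β) (H : β → β → Prop) (S : Set V) : Prop :=
  HIndep A c H S ∧
    ∀ z, z ∉ S → (∃ s ∈ S, HPathExists A c H s z) → ∃ s ∈ S, HPathExists A c H z s

/-- `S` is an `H`-semikernel modulo `D₂` of `D` (here `A` is the arc relation of `D` and
`A1` that of `D₁`): `S` is `H`-independent in `D` and whenever there is an `H`-path
contained in `D₁` from `S` to a vertex `z ∉ S`, there is an `H`-path in `D` from `z` to `S`. -/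
def IsHSemikernelMod (A A1 : V → V → Prop) (c : V → V → β) (H : β → β → Prop)
    (S : Set V) : Prop :=
  HIndep A c H S ∧
    ∀ z, z ∉ S → (∃ s ∈ S, HPathExists A1 c H s z) → ∃ s ∈ S, HPathExists A c H z s

/-- There is an `H`-obstruction at the common vertex of the concatenation of `P` and `Q`:
the pair (color of last arc of `P`, color of first arc of `Q`) is not an arc of `H`. -/
def Obstruct (c : V → V → β) (H : β → β → Prop) (P Q : List V) : Prop :=
  ∀ a ∈ (arcColors c P).getLast?, ∀ b ∈ (arcColors c Q).head?, ¬ H a b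

/-- A `ux`-path which is a `(ξ₁, ξ, ξ₂)`-`H`-subdivision of `P⃗₃`: a path of `D` (arc
relation `A`) from `u` to `x` consisting of an `H`-path contained in `D₁` (arc relation
`A1`), followed by an `H`-path contained in `D`, followed by an `H`-path contained in `D₂`
(arc relation `A2`), with `H`-obstructions at the two junction vertices. -/
def SubdivP3 (A1 A A2 : V → V → Prop) (c : V → V → β) (H : β → β → Prop) (u x : V) : Prop :=
  ∃ P1 P2 P3 : List V,
    IsHPath A1 c H P1 ∧ IsHPath A c H P2 ∧ IsHPath A2 c H P3 ∧
    P1.head? = some u ∧ P3.getLast? = some x ∧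
    P1.getLast? = P2.head? ∧ P2.getLast? = P3.head? ∧
    (P1 ++ P2.tail ++ P3.tail).Nodup ∧
    Obstruct c H P1 P2 ∧ Obstruct c H P2 P3

/-- A `(ξ₁, ξ, ξ₂)`-`H`-subdivision of `C⃗₃`: a cycle of `D` consisting of an `H`-path
contained in `D₁`, followed by an `H`-path contained in `D`, followed by an `H`-path
contained in `D₂` closing the cycle, with `H`-obstructions at the three junction vertices. -/
def SubdivC3 (A1 A A2 : V → V → Prop) (c : V → V → β) (H : β → β → Prop) : Prop :=
  ∃ P1 P2 P3 : List V,
    IsHPath A1 c H P1 ∧ IsHPath A c H P2 ∧ IsHPath A2 c H P3 ∧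
    P1.getLast? = P2.head? ∧ P2.getLast? = P3.head? ∧ P3.getLast? = P1.head? ∧
    (P1 ++ P2.tail ++ P3.tail.dropLast).Nodup ∧
    Obstruct c H P3 P1 ∧ Obstruct c H P1 P2 ∧ Obstruct c H P2 P3

/-- There is a rainbow path (a path all of whose arc colors are pairwise distinct) from
`u` to `v` in the digraph with arc relation `A`. -/
def RainbowPathExists (A : V → V → Prop) (c : V → V → β) (u v : V) : Prop :=
  ∃ l, IsHPathFrom A c (fun _ _ => True) u v l ∧ (arcColors c l).Nodup

theorem exists_nodup_isChain_of_reflTransGen {α : Type*} {r : α → α → Prop} {a b : α}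
    (h : Relation.ReflTransGen r a b) :
    ∃ l : List α, (a :: l).Nodup ∧ (a :: l).IsChain r ∧ (a :: l).getLast? = some b := by
  induction h using Relation.ReflTransGen.head_induction_on with
  | refl => exact ⟨[], by simp⟩
  | @head a x hax _ ih =>
    obtain ⟨l, hnd, hch, hlast⟩ := ih
    by_cases ha : a ∈ x :: l
    · obtain ⟨s, t, hst⟩ := List.append_of_mem ha
      rw [hst] at hnd hch hlast
      refine ⟨t, hnd.of_append_right, hch.right_of_append, ?_⟩
      simpa [List.getLast?_append] using hlast
    · exact ⟨x :: l, List.nodup_cons.2 ⟨ha, hnd⟩, List.isChain_cons_cons.2 ⟨hax, hch⟩, by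
        rwa [List.getLast?_cons_cons]⟩

/-- The arcs of `r` joining distinct vertices form an acyclic digraph if `r` has no cycle of
length at least two. -/
theorem not_transGen_ne_self {α : Type*} {r : α → α → Prop} (h : ∀ l, ¬ IsCycle r l) (a : α) :
    ¬ Relation.TransGen (fun x y => r x y ∧ x ≠ y) a a := by
  intro ha
  obtain ⟨b, hab, hba⟩ := Relation.TransGen.head'_iff.1 ha
  obtain ⟨l, hnd, hch, hlast⟩ := exists_nodup_isChain_of_reflTransGen hba
  refine h (b :: l) ⟨?_, hnd, hch.imp fun _ _ h => h.1, ?_⟩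
  · rcases l with _ | ⟨x, l⟩
    · exact absurd (by simpa using hlast.symm) hab.2
    · simp
  · simp only [hlast, List.head?_cons, Option.mem_some_iff, forall_eq']
    exact hab.1

@[simp]
theorem arcColors_cons_cons (c : V → V → β) (u v : V) (l : List V) :
    arcColors c (u :: v :: l) = c u v :: arcColors c (v :: l) := by
  simp [arcColors]

theorem List.IsChain.nodup_of_transGen_irrefl {α : Type*} {r : α → α → Prop}
    (hr : ∀ a, ¬ Relation.TransGen r a a) {l : List α} (hl : l.IsChain r) : l.Nodup := by
  have hp : l.Pairwise (Relation.TransGen r) :=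
    (hl.imp fun _ _ h => Relation.TransGen.single h).pairwise
  exact hp.imp (S := (· ≠ ·)) fun hab e => hr _ (e ▸ hab)

section TransitiveClasses

variable {D : V → V → Prop} {c : V → V → β}

/-- A directed walk is an arc, or its first and last colors are joined by a nontrivial walk in
the loopless part of the color-class digraph. -/
theorem adj_or_transGen_color_of_transGen
    (htrans : ∀ a b d : V, D a b → D b d → c a b = c b d → D a d ∧ c a d = c a b)
    {u v : V} (h : Relation.TransGen D u v) :
    D u v ∨ ∃ x y, D u x ∧ D y v ∧
      Relation.TransGen (fun a b => CCArc D c a b ∧ a ≠ b) (c u x) (c y v) := by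
  induction h using Relation.TransGen.head_induction_on with
  | single h => exact .inl h
  | @head u w huw _ ih =>
    rcases ih with hwv | ⟨x, y, hwx, hyv, hxy⟩
    · by_cases e : c u w = c w v
      · exact .inl (htrans u w v huw hwv e).1
      · exact .inr ⟨w, w, huw, hwv, .single ⟨⟨u, w, v, huw, hwv, rfl, rfl⟩, e⟩⟩
    · refine .inr ⟨w, y, huw, hyv, ?_⟩
      by_cases e : c u w = c w x
      · rwa [e]
      · exact hxy.head ⟨⟨u, w, x, huw, hwx, rfl, rfl⟩, e⟩

theorem not_transGen_self_of_transitive_classes (hloop : ∀ v : V, ¬ D v v)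
    (htrans : ∀ a b d : V, D a b → D b d → c a b = c b d → D a d ∧ c a d = c a b)
    (hnocyc : ∀ γ : List β, ¬ IsCycle (CCArc D c) γ) (v : V) :
    ¬ Relation.TransGen D v v := by
  intro h
  rcases adj_or_transGen_color_of_transGen htrans h with h | ⟨x, y, hvx, hyv, hxy⟩
  · exact hloop v h
  · by_cases e : c y v = c v x
    · exact not_transGen_ne_self hnocyc _ (e ▸ hxy)
    · exact not_transGen_ne_self hnocyc _ (hxy.tail ⟨⟨y, v, x, hyv, hvx, rfl, rfl⟩, e⟩)

/-- A walk can be prolonged by an arc at its start, the arc being merged into the walk when its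
color is that of the first arc, so that consecutive arcs keep distinct colors. -/
theorem exists_walk_cons_of_adj
    (htrans : ∀ a b d : V, D a b → D b d → c a b = c b d → D a d ∧ c a d = c a b)
    {u w x : V} {l : List V} (huw : D u w) (hD : (w :: x :: l).IsChain D)
    (hc : (arcColors c (w :: x :: l)).IsChain fun a b => CCArc D c a b ∧ a ≠ b) :
    ∃ x' l', (u :: x' :: l').IsChain D ∧
      ((arcColors c (u :: x' :: l')).IsChain fun a b => CCArc D c a b ∧ a ≠ b) ∧
      (u :: x' :: l').getLast? = (w :: x :: l).getLast? := by
  obtain ⟨hwx, hD'⟩ := List.isChain_cons_cons.1 hD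
  by_cases e : c u w = c w x
  · obtain ⟨hux, hcux⟩ := htrans u w x huw hwx e
    refine ⟨x, l, List.isChain_cons_cons.2 ⟨hux, hD'⟩, ?_, by simp⟩
    rw [arcColors_cons_cons] at hc ⊢
    rwa [hcux, e]
  · refine ⟨w, x :: l, List.isChain_cons_cons.2 ⟨huw, hD⟩, ?_, by simp⟩
    rw [arcColors_cons_cons] at hc
    simp only [arcColors_cons_cons]
    exact List.isChain_cons_cons.2 ⟨⟨⟨u, w, x, huw, hwx, rfl, rfl⟩, e⟩, hc⟩

theorem exists_walk_to_sink [Finite V] (hacyc : ∀ v : V, ¬ Relation.TransGen D v v)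
    (htrans : ∀ a b d : V, D a b → D b d → c a b = c b d → D a d ∧ c a d = c a b)
    (u : V) (hu : ∃ w, D u w) :
    ∃ v, (∀ w, ¬ D v w) ∧ ∃ x l, (u :: x :: l).IsChain D ∧
      ((arcColors c (u :: x :: l)).IsChain fun a b => CCArc D c a b ∧ a ≠ b) ∧
      (u :: x :: l).getLast? = some v := by
  have : IsTrans V fun a b => Relation.TransGen D b a := ⟨fun _ _ _ h₁ h₂ => h₂.trans h₁⟩
  have : Std.Irrefl fun a b : V => Relation.TransGen D b a := ⟨hacyc⟩
  have hwf := Finite.wellFounded_of_trans_of_irrefl fun a b : V => Relation.TransGen D b a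
  induction u using hwf.induction with
  | _ u ih =>
    obtain ⟨w, huw⟩ := hu
    by_cases hw : ∃ x, D w x
    · obtain ⟨v, hv, x, l, hD, hc, hl⟩ := ih w (.single huw) hw
      obtain ⟨x', l', hD', hc', hl'⟩ := exists_walk_cons_of_adj htrans huw hD hc
      exact ⟨v, hv, x', l', hD', hc', hl'.trans hl⟩
    · exact ⟨w, not_exists.1 hw, w, [], by simp [huw], by simp [arcColors], by simp⟩

end TransitiveClasses

theorem statement_16
    {V β : Type*} [Fintype V] [Fintype β]
    (D : V → V → Prop) (c : V → V → β)
    (hloop : ∀ v : V, ¬ D v v)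
    (hnoiso : ∀ v : V, ∃ u : V, D v u ∨ D u v)
    (htrans : ∀ a b d : V, D a b → D b d → c a b = c b d → D a d ∧ c a d = c a b)
    (hnocyc : ∀ γ : List β, ¬ IsCycle (CCArc D c) γ) :
    ∃ N : Set V,
      (∀ u ∈ N, ∀ v ∈ N, u ≠ v → ¬ RainbowPathExists D c u v) ∧
      (∀ u : V, u ∉ N → ∃ v ∈ N, RainbowPathExists D c u v) := by
  have hacyc := not_transGen_self_of_transitive_classes hloop htrans hnocyc
  refine ⟨{v | ∀ w, ¬ D v w}, ?_, ?_⟩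
  · rintro u hu v - - ⟨l, ⟨⟨⟨hlen, hD, -⟩, -⟩, hhead, -⟩, -⟩
    match l, hlen with
    | a :: b :: l, _ =>
      obtain rfl : a = u := by simpa using hhead
      exact hu b (List.isChain_cons_cons.1 hD).1
  · intro u hu
    obtain ⟨v, hv, x, l, hD, hc, hlast⟩ :=
      exists_walk_to_sink (c := c) hacyc htrans u (by simpa using hu)
    refine ⟨v, hv, u :: x :: l, ⟨⟨⟨by simp, hD, hc.imp fun _ _ _ => trivial⟩, ?_⟩, rfl, hlast⟩, ?_⟩
    · exact hD.nodup_of_transGen_irrefl hacyc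
    · exact hc.nodup_of_transGen_irrefl (not_transGen_ne_self hnocyc)
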